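/- There are no rational numbers a, z, w with a ≠ 0, z ≠ w, z³ + a = a·z²·w and w³ + a = a·w²·z. Equivalently, for no parameter a ∈ ℚ \ {0} does the map f_a(z) = (z³ + a)/(a·z²) have a ℚ-rational periodic point of minimal period 2. -/

import Mathlib

/-- If a product of coprime integers `m`, `n` and their sum is a cube, then it vanishes. -/
theorem mul_mul_add_eq_zero_of_eq_cube {m n k : ℤ} (hmn : IsCoprime m n)
    (h : m * n * (m + n) = k ^ 3) : m * n * (m + n) = 0 := by
  by_contra h0
  obtain ⟨⟨hm0, hn0⟩, hadd0⟩ : (m ≠ 0 ∧ n ≠ 0) ∧ m + n ≠ 0 := by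
    simpa only [ne_eq, mul_eq_zero, not_or] using h0
  have hm_add : IsCoprime m (m + n) := by simpa using hmn.mul_add_left_right 1
  have hn_add : IsCoprime n (m + n) := by simpa using hmn.symm.add_mul_left_right 1
  obtain ⟨hmul, z, hz⟩ := Int.eq_pow_of_mul_eq_pow_odd (hm_add.mul_left hn_add) (by decide) h
  obtain ⟨c, hc⟩ := hmul
  obtain ⟨⟨x, hx⟩, y, hy⟩ := Int.eq_pow_of_mul_eq_pow_odd hmn (by decide) hc
  exact fermatLastTheoremFor_iff_int.mp fermatLastTheoremThree x y z
    (ne_zero_pow three_ne_zero (hx ▸ hm0)) (ne_zero_pow three_ne_zero (hy ▸ hn0))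
    (ne_zero_pow three_ne_zero (hz ▸ hadd0)) (by rw [← hx, ← hy, ← hz])

/-- The only affine rational points on the elliptic curve `t (t + 1) = u ^ 3` have `u = 0`. -/
theorem eq_zero_of_mul_add_one_eq_cube {t u : ℚ} (h : t * (t + 1) = u ^ 3) : u = 0 := by
  have hd : (t.den : ℚ) ≠ 0 := by exact_mod_cast t.den_nz
  have ht : t * t.den = t.num := Rat.mul_den_eq_num t
  have hcube : (u * t.den) ^ 3 = ((t.num * t.den * (t.num + t.den) : ℤ) : ℚ) := by
    push_cast
    rw [← ht, mul_pow, ← h]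
    ring
  have hden : (u * t.den).den = 1 := by
    have hpow := congrArg Rat.den hcube
    rw [Rat.den_pow, Rat.den_intCast] at hpow
    exact (Nat.pow_eq_one.mp hpow).resolve_right three_ne_zero
  have hint : (((u * t.den).num : ℤ) : ℚ) = u * t.den := Rat.den_eq_one_iff _ |>.mp hden
  have hzero := mul_mul_add_eq_zero_of_eq_cube (k := (u * t.den).num)
    (Rat.isCoprime_num_den t) (by
      rw [← hint] at hcube
      exact_mod_cast hcube.symm)
  rw [hzero, Int.cast_zero] at hcube
  exact (mul_eq_zero.mp (pow_eq_zero_iff (by norm_num) |>.mp hcube)).resolve_right hd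

/-- There are no rationals `a, z, w` with `a ≠ 0`, `z ≠ w`,
`z³ + a = a·z²·w` and `w³ + a = a·w²·z`; i.e. no member of the family
`f_a(z) = (z³ + a)/(a z²)` has a ℚ-rational point of minimal period 2. -/
theorem A3C3_no_rational_two_cycle :
    ¬ ∃ a z w : ℚ, a ≠ 0 ∧ z ≠ w ∧
      z ^ 3 + a = a * z ^ 2 * w ∧ w ^ 3 + a = a * w ^ 2 * z := by
  rintro ⟨a, z, w, ha, hzw, h₁, h₂⟩
  have hz : z ≠ 0 := by
    rintro rfl
    simp_all
  have hw : w ≠ 0 := by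
    rintro rfl
    simp_all
  have hp : z * w ≠ 0 := mul_ne_zero hz hw
  have hquad : z ^ 2 + z * w + w ^ 2 = a * (z * w) :=
    mul_left_cancel₀ (sub_ne_zero.mpr hzw) (by linear_combination h₁ - h₂)
  have ha_eq : a = z * w * (z + w) := by linear_combination h₁ - z * hquad
  have hcurve : (z + w) * (z + w - (z * w) ^ 2) = z * w := by
    linear_combination hquad + z * w * ha_eq
  have hu : (z * w)⁻¹ = 0 :=
    eq_zero_of_mul_add_one_eq_cube (t := (z + w - (z * w) ^ 2) / (z * w) ^ 2) (by
      rw [div_add_one (pow_ne_zero 2 hp), sub_add_cancel, div_mul_div_comm,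
        mul_comm (z + w - (z * w) ^ 2), hcurve]
      field_simp)
  exact inv_ne_zero hp hu
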